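/- Let n ≥ 2 be an integer. For τ > 0 and x, w ∈ ℝⁿ define β_τ(x,w) = 4|x|²(τ+|w-x|²)/(τ+|w-x|²+|x|²)², J_τ(x,w) = ∫₀¹ u^{(n-1)/2 - 1} (1-u)^{(n-3)/2} (1-β_τ(x,w)u)^{-(n-1)/2} du, and D_τ(w) = |w|^{n-1} ∫_{ℝⁿ} |x|^{n-2} |x-w|^{-(n-1)} (τ+|x-w|²+|x|²)^{1-n} J_τ(x,w) dx. Then D_τ(w) = D₁(τ^{-1/2} w) for all τ > 0 and w ∈ ℝⁿ, and sup_{τ > 0, w ∈ ℝⁿ} D_τ(w) < ∞. -/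

import Mathlib

open MeasureTheory Real

/-- The delta-free evaluation `D_τ(w)` (up to an explicit constant depending only on `n`)
of the triple hyperbolic-surface convolution with uniform exponents
`α₁ = α₂ = λ = n-1` and `σ = n-1`. -/
noncomputable def KMTripleConv (n : ℕ) (τ : ℝ) (w : EuclideanSpace ℝ (Fin n)) : ℝ :=
  ‖w‖ ^ ((n : ℝ) - 1) *
    ∫ x : EuclideanSpace ℝ (Fin n),
      ‖x‖ ^ ((n : ℝ) - 2) * ‖x - w‖ ^ (-((n : ℝ) - 1)) *
        (τ + ‖x - w‖ ^ 2 + ‖x‖ ^ 2) ^ (1 - (n : ℝ)) *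
        ∫ u in (0:ℝ)..1,
          u ^ (((n : ℝ) - 1) / 2 - 1) * (1 - u) ^ (((n : ℝ) - 3) / 2) *
            (1 - (4 * ‖x‖ ^ 2 * (τ + ‖w - x‖ ^ 2) /
              (τ + ‖w - x‖ ^ 2 + ‖x‖ ^ 2) ^ 2) * u) ^ (-((n : ℝ) - 1) / 2)

/-- Integrals of `|·|^(-1/2)` over unit intervals are uniformly bounded. -/
lemma exists_setLIntegral_abs_add_rpow_le :
    ∃ C : ENNReal, C ≠ ⊤ ∧ ∀ s : ℝ,
      ∫⁻ t in Set.Icc (0:ℝ) 1, ENNReal.ofReal |t + s| ^ (-(1/2) : ℝ) ≤ C := by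
  let g : ℝ → ENNReal := (Set.Icc (-1:ℝ) 1).indicator fun v => ENNReal.ofReal |v| ^ (-(1/2) : ℝ)
  have hg : ∫⁻ v, g v ≠ ⊤ := by
    have h_int : IntegrableOn (fun v : ℝ => |v| ^ (-(1/2) : ℝ)) (Set.Icc (-1) 1) := by
      have h1 : IntervalIntegrable (fun v : ℝ => |v| ^ (-(1/2) : ℝ)) volume 0 1 := by
        refine (intervalIntegral.intervalIntegrable_rpow' (r := -(1/2)) (by norm_num)).congr ?_
        intro v hv
        rw [Set.uIoc_of_le zero_le_one] at hv
        simp only [abs_of_pos hv.1]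
      have h2 : IntervalIntegrable (fun v : ℝ => |v| ^ (-(1/2) : ℝ)) volume (-1) 0 := by
        rw [IntervalIntegrable.iff_comp_neg]
        simpa using h1.symm
      have h3 := h2.trans h1
      rwa [intervalIntegrable_iff_integrableOn_Icc_of_le (by norm_num)] at h3
    rw [lintegral_indicator measurableSet_Icc]
    refine ((lintegral_congr_ae ?_).trans_lt h_int.lintegral_lt_top).ne
    have : ∀ᵐ v : ℝ, v ≠ 0 := by simp [ae_iff]
    filter_upwards [ae_restrict_of_ae this] with v hv
    exact ENNReal.ofReal_rpow_of_pos (abs_pos.2 hv)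
  refine ⟨(∫⁻ v, g v) + 1, by simp [hg], fun s => ?_⟩
  have key : ∀ v : ℝ, ENNReal.ofReal |v| ^ (-(1/2) : ℝ) ≤ g v + 1 := by
    intro v
    by_cases hv : v ∈ Set.Icc (-1:ℝ) 1
    · simp [g, hv]
    · have h1 : 1 ≤ |v| := by
        by_contra! h
        exact hv ⟨(abs_lt.1 h).1.le, (abs_lt.1 h).2.le⟩
      have : ENNReal.ofReal |v| ^ (-(1/2) : ℝ) ≤ 1 := by
        apply ENNReal.rpow_le_one_of_one_le_of_neg _ (by norm_num)
        simpa using ENNReal.ofReal_le_ofReal h1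
      exact this.trans le_add_self
  calc ∫⁻ t in Set.Icc (0:ℝ) 1, ENNReal.ofReal |t + s| ^ (-(1/2) : ℝ)
      ≤ ∫⁻ t in Set.Icc (0:ℝ) 1, (g (t + s) + 1) := lintegral_mono fun t => key _
    _ = (∫⁻ t in Set.Icc (0:ℝ) 1, g (t + s)) + 1 := by
        rw [lintegral_add_right _ measurable_const]; simp
    _ ≤ (∫⁻ t, g (t + s)) + 1 := by gcongr; exact Measure.restrict_le_self
    _ = _ := by rw [lintegral_add_right_eq_self g s]

lemma one_add_norm_sq_le {E : Type*} [NormedAddCommGroup E] {y z : E} (hz : ‖z‖ ≤ 1) :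
    1 + ‖y‖ ^ 2 ≤ 3 * (1 + ‖y + z‖ ^ 2) := by
  have h : ‖y‖ ≤ ‖y + z‖ + 1 := by
    calc ‖y‖ = ‖(y + z) - z‖ := by simp
      _ ≤ ‖y + z‖ + ‖z‖ := norm_sub_le _ _
      _ ≤ _ := by gcongr
  nlinarith [norm_nonneg y, norm_nonneg (y + z), sq_nonneg (‖y + z‖ - 1/2)]

lemma exists_lintegral_japanese_mul_hyperplane_le {E : Type*} [NormedAddCommGroup E]
    [InnerProductSpace ℝ E] [FiniteDimensional ℝ E] [MeasurableSpace E] [BorelSpace E]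
    {N : ℝ} (hN : Module.finrank ℝ E < 2 * N) :
    ∃ C : ENNReal, C ≠ ⊤ ∧ ∀ e : E, ‖e‖ = 1 → ∀ c : ℝ,
      ∫⁻ y : E, ENNReal.ofReal ((1 + ‖y‖ ^ 2) ^ (-N)) *
        ENNReal.ofReal |inner ℝ y e - c| ^ (-(1/2) : ℝ) ≤ C := by
  have hN0 : 0 ≤ N := by
    have : (0:ℝ) ≤ Module.finrank ℝ E := Nat.cast_nonneg _
    linarith
  obtain ⟨C, hC, hCb⟩ := exists_setLIntegral_abs_add_rpow_le
  have h_int : ∫⁻ y : E, ENNReal.ofReal ((1 + ‖y‖ ^ 2) ^ (-N)) ≠ ⊤ := by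
    have := (integrable_rpow_neg_one_add_norm_sq (μ := (volume : Measure E)) hN).lintegral_lt_top.ne
    rwa [show -(2 * N) / 2 = -N by ring] at this
  refine ⟨ENNReal.ofReal (3 ^ N) * C * ∫⁻ y : E, ENNReal.ofReal ((1 + ‖y‖ ^ 2) ^ (-N)),
    ENNReal.mul_ne_top (ENNReal.mul_ne_top ENNReal.ofReal_ne_top hC) h_int, fun e he c => ?_⟩
  set F : E → ENNReal := fun y => ENNReal.ofReal ((1 + ‖y‖ ^ 2) ^ (-N)) *
        ENNReal.ofReal |inner ℝ y e - c| ^ (-(1/2) : ℝ) with hF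
  have hFm : Measurable F := by
    rw [hF]; fun_prop
  calc ∫⁻ y, F y = ∫⁻ t in Set.Icc (0:ℝ) 1, ∫⁻ y, F (y + t • e) := by
        simp [lintegral_add_right_eq_self F]
    _ = ∫⁻ y, ∫⁻ t in Set.Icc (0:ℝ) 1, F (y + t • e) := by
        apply lintegral_lintegral_swap
        exact Measurable.aemeasurable (by unfold Function.uncurry; fun_prop)
    _ ≤ ∫⁻ y, ENNReal.ofReal (3 ^ N) * ENNReal.ofReal ((1 + ‖y‖ ^ 2) ^ (-N)) * C := by
        refine lintegral_mono fun y => ?_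
        refine le_trans ?_ (mul_le_mul_right (hCb (inner ℝ y e - c)) _)
        rw [← lintegral_const_mul _ (by fun_prop)]
        refine setLIntegral_mono (by fun_prop) fun t ht => ?_
        have h1 : ‖t • e‖ ≤ 1 := by
          rw [norm_smul, he, mul_one, Real.norm_eq_abs, abs_of_nonneg ht.1]; exact ht.2
        have h2 : inner ℝ (y + t • e) e - c = t + (inner ℝ y e - c) := by
          rw [inner_add_left, real_inner_smul_left, real_inner_self_eq_norm_sq, he]; ring
        simp only [hF, h2]
        gcongr
        rw [← ENNReal.ofReal_mul (by positivity)]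
        apply ENNReal.ofReal_le_ofReal
        rw [Real.rpow_neg (by positivity), Real.rpow_neg (by positivity), ← div_eq_mul_inv,
          le_div_iff₀ (by positivity), inv_mul_le_iff₀ (by positivity), mul_comm,
          ← Real.mul_rpow (by positivity) (by positivity)]
        exact Real.rpow_le_rpow (by positivity) (one_add_norm_sq_le h1) hN0
    _ = _ := by
        rw [lintegral_mul_const _ (by fun_prop), lintegral_const_mul _ (by fun_prop)]; ring

lemma integrable_norm_rpow_mul_japanese {E : Type*} [NormedAddCommGroup E]
    [NormedSpace ℝ E] [FiniteDimensional ℝ E] [Nontrivial E] [MeasurableSpace E] [BorelSpace E]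
    (μ : Measure E) [μ.IsAddHaarMeasure] :
    Integrable (fun y : E => ‖y‖ ^ (-((Module.finrank ℝ E : ℝ) - 1/2)) *
      (1 + ‖y‖ ^ 2) ^ (-(1/2) : ℝ)) μ := by
  refine (integrable_fun_norm_addHaar μ
    (f := fun r => r ^ (-((Module.finrank ℝ E : ℝ) - 1/2)) * (1 + r ^ 2) ^ (-(1/2) : ℝ))).2 ?_
  have hd : 1 ≤ Module.finrank ℝ E := Module.finrank_pos
  have heq : ∀ r ∈ Set.Ioi (0:ℝ), r ^ (Module.finrank ℝ E - 1) •
      (r ^ (-((Module.finrank ℝ E : ℝ) - 1/2)) * (1 + r ^ 2) ^ (-(1/2) : ℝ)) =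
      r ^ (-(1/2) : ℝ) * (1 + r ^ 2) ^ (-(1/2) : ℝ) := by
    intro r hr
    rw [smul_eq_mul, ← mul_assoc, ← Real.rpow_natCast, ← Real.rpow_add hr]
    congr 2
    push_cast [hd]; ring
  rw [integrableOn_congr_fun heq measurableSet_Ioi, ← Set.Ioc_union_Ioi_eq_Ioi zero_le_one]
  refine IntegrableOn.union ?_ ?_
  · have h := (intervalIntegrable_iff_integrableOn_Ioc_of_le zero_le_one).1
      (intervalIntegral.intervalIntegrable_rpow' (r := -(1/2)) (a := 0) (b := 1) (by norm_num))
    refine h.mono' (Measurable.aestronglyMeasurable (by fun_prop)) ?_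
    filter_upwards [ae_restrict_mem measurableSet_Ioc] with r hr
    have hr0 := hr.1
    rw [Real.norm_of_nonneg (by positivity)]
    exact mul_le_of_le_one_right (by positivity)
      (Real.rpow_le_one_of_one_le_of_nonpos (by nlinarith) (by norm_num))
  · have h := integrableOn_Ioi_rpow_of_lt (a := -(3/2)) (by norm_num) (zero_lt_one (α := ℝ))
    refine h.mono' (Measurable.aestronglyMeasurable (by fun_prop)) ?_
    filter_upwards [ae_restrict_mem measurableSet_Ioi] with r hr
    have hr0 : 0 < r := zero_lt_one.trans hr
    rw [Real.norm_of_nonneg (by positivity)]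
    have : (1 + r ^ 2) ^ (-(1/2) : ℝ) ≤ r ^ (-1 : ℝ) := by
      calc (1 + r ^ 2) ^ (-(1/2) : ℝ) ≤ (r ^ 2) ^ (-(1/2) : ℝ) :=
            Real.rpow_le_rpow_of_nonpos (by positivity) (by linarith) (by norm_num)
        _ = _ := by rw [← Real.rpow_natCast, ← Real.rpow_mul hr0.le]; norm_num
    calc _ ≤ r ^ (-(1/2) : ℝ) * r ^ (-1 : ℝ) := by gcongr
      _ = _ := by rw [← Real.rpow_add hr0]; norm_num

lemma integrableOn_rpow_mul_one_sub_rpow {a b : ℝ} (ha : 0 < a) (hb : 0 < b) :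
    IntegrableOn (fun u : ℝ => u ^ (a - 1) * (1 - u) ^ (b - 1)) (Set.Ioc 0 1) := by
  have h := Complex.betaIntegral_convergent (u := a) (v := b) (by simpa) (by simpa)
  rw [intervalIntegrable_iff_integrableOn_Ioc_of_le zero_le_one] at h
  refine IntegrableOn.congr_fun h.norm (fun u hu => ?_) measurableSet_Ioc
  have h1 : 0 ≤ 1 - u := by linarith [hu.2]
  have e : (u : ℂ) ^ ((a : ℂ) - 1) * (1 - (u : ℂ)) ^ ((b : ℂ) - 1) =
      ((u ^ (a - 1) * (1 - u) ^ (b - 1) : ℝ) : ℂ) := by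
    push_cast [Complex.ofReal_cpow hu.1.le, Complex.ofReal_cpow h1]; rfl
  simp only [e, Complex.norm_real]
  exact Real.norm_of_nonneg (mul_nonneg (Real.rpow_nonneg hu.1.le _) (Real.rpow_nonneg h1 _))

lemma exists_euler_integral_le {m δ : ℝ} (hδ : 0 < δ) (hδm : δ ≤ (m - 1) / 2) :
    ∃ K : ℝ, 0 ≤ K ∧ ∀ β : ℝ, 0 ≤ β → β < 1 →
      ∫ u in (0:ℝ)..1, u ^ ((m - 1) / 2 - 1) * (1 - u) ^ ((m - 3) / 2) *
        (1 - β * u) ^ (-(m - 1) / 2) ≤ K * (1 - β) ^ (-δ) := by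
  have h_int := integrableOn_rpow_mul_one_sub_rpow (a := (m - 1) / 2) (by linarith) hδ
  refine ⟨∫ u in Set.Ioc (0:ℝ) 1, u ^ ((m - 1) / 2 - 1) * (1 - u) ^ (δ - 1),
    setIntegral_nonneg measurableSet_Ioc fun u hu => mul_nonneg (Real.rpow_nonneg hu.1.le _)
      (Real.rpow_nonneg (by linarith [hu.2]) _), fun β hβ0 hβ1 => ?_⟩
  rw [intervalIntegral.integral_of_le zero_le_one, integral_Ioc_eq_integral_Ioo,
    integral_Ioc_eq_integral_Ioo, ← integral_mul_const]
  refine integral_mono_of_nonneg ?_ ((h_int.mono_set Set.Ioo_subset_Ioc_self).mul_const _) ?_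
  · filter_upwards [ae_restrict_mem measurableSet_Ioo] with u hu
    have h0 := hu.1
    have h1 : 0 < 1 - u := by linarith [hu.2]
    have h2 : 0 < 1 - β * u := by nlinarith
    simp only [Pi.zero_apply]
    positivity
  · filter_upwards [ae_restrict_mem measurableSet_Ioo] with u hu
    have h0 := hu.1
    have h1 : 0 < 1 - u := by linarith [hu.2]
    have h2 : 0 < 1 - β * u := by nlinarith
    have h3 : 0 < 1 - β := by linarith
    have key : (1 - β * u) ^ (-(m - 1) / 2) ≤ (1 - u) ^ (δ - (m - 1) / 2) * (1 - β) ^ (-δ) := by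
      rw [show -(m - 1) / 2 = (δ - (m - 1) / 2) + -δ by ring, Real.rpow_add h2]
      gcongr ?_ * ?_
      · exact Real.rpow_le_rpow_of_nonpos h1 (by nlinarith) (by linarith)
      · exact Real.rpow_le_rpow_of_nonpos h3 (by nlinarith) (by linarith)
    calc u ^ ((m - 1) / 2 - 1) * (1 - u) ^ ((m - 3) / 2) * (1 - β * u) ^ (-(m - 1) / 2)
        ≤ u ^ ((m - 1) / 2 - 1) * (1 - u) ^ ((m - 3) / 2) *
          ((1 - u) ^ (δ - (m - 1) / 2) * (1 - β) ^ (-δ)) := by gcongr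
      _ = u ^ ((m - 1) / 2 - 1) * ((1 - u) ^ ((m - 3) / 2) * (1 - u) ^ (δ - (m - 1) / 2)) *
          (1 - β) ^ (-δ) := by ring
      _ = _ := by rw [← Real.rpow_add h1]; congr 3; ring

lemma euler_integral_nonneg {m β : ℝ} (hβ : β ≤ 1) :
    0 ≤ ∫ u in (0:ℝ)..1, u ^ ((m - 1) / 2 - 1) * (1 - u) ^ ((m - 3) / 2) *
        (1 - β * u) ^ (-(m - 1) / 2) := by
  refine intervalIntegral.integral_nonneg zero_le_one fun u hu => ?_
  have h0 := hu.1
  have h1 : 0 ≤ 1 - u := by linarith [hu.2]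
  have h2 : 0 ≤ 1 - β * u := by nlinarith
  positivity

/-- Young's inequality splits the point singularity from the hyperplane singularity. -/
lemma rpow_mul_rpow_le_add {r Y h : ℝ} (hr : 2 ≤ r) (hY : 0 ≤ Y) (hh : 0 ≤ h) :
    Y ^ (-(r - 1)) * (1 + Y ^ 2) ^ (-(r / 2) + 1 / (2 * (2 * r - 1))) *
        h ^ (-(1 / (2 * (2 * r - 1)))) ≤
      Y ^ (-(r - 1/2)) * (1 + Y ^ 2) ^ (-(1/2) : ℝ) +
        (1 + Y ^ 2) ^ (-((r + 1) / 2)) * h ^ (-(1/2) : ℝ) := by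
  have hP0 : 0 < 1 + Y ^ 2 := by positivity
  have hP : 1 ≤ 1 + Y ^ 2 := by nlinarith
  generalize 1 + Y ^ 2 = P at *
  have hr1 : 0 < r - 1 := by linarith
  have hr2 : 0 < 2 * r - 1 := by linarith
  have hr2' : r * 2 - 1 ≠ 0 := by rw [mul_comm]; exact hr2.ne'
  obtain ⟨p, hp⟩ : ∃ p : ℝ, p = (2 * r - 1) / (2 * (r - 1)) := ⟨_, rfl⟩
  obtain ⟨q, hq⟩ : ∃ q : ℝ, q = 2 * r - 1 := ⟨_, rfl⟩
  have hpq : p.HolderConjugate q := by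
    rw [Real.holderConjugate_iff]
    constructor
    · rw [hp, lt_div_iff₀ (by positivity)]; linarith
    · rw [hp, hq]; field_simp; ring
  have hy := Real.young_inequality_of_nonneg
    (a := Y ^ (-(r - 1)) * P ^ (-((r - 1) / (2 * r - 1))))
    (b := P ^ (-((r + 1) / (2 * (2 * r - 1)))) * h ^ (-(1 / (2 * (2 * r - 1)))))
    (by positivity) (by positivity) hpq
  have h1 : P ^ (-(r / 2) + 1 / (2 * (2 * r - 1))) ≤
      P ^ (-((r - 1) / (2 * r - 1))) * P ^ (-((r + 1) / (2 * (2 * r - 1)))) := by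
    rw [← Real.rpow_add hP0]
    apply Real.rpow_le_rpow_of_exponent_le hP
    rw [← sub_nonneg]
    have : -((r - 1) / (2 * r - 1)) + -((r + 1) / (2 * (2 * r - 1))) -
        (-(r / 2) + 1 / (2 * (2 * r - 1))) = r * (r - 2) / (2 * r - 1) := by
      field_simp; ring
    rw [this]
    exact div_nonneg (mul_nonneg (by linarith) (by linarith)) hr2.le
  have e1 : (Y ^ (-(r - 1)) * P ^ (-((r - 1) / (2 * r - 1)))) ^ p =
      Y ^ (-(r - 1/2)) * P ^ (-(1/2) : ℝ) := by
    rw [Real.mul_rpow (by positivity) (by positivity), ← Real.rpow_mul hY, ← Real.rpow_mul hP0.le]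
    congr 2 <;> · rw [hp]; field_simp; try ring
  have e2 : (P ^ (-((r + 1) / (2 * (2 * r - 1)))) * h ^ (-(1 / (2 * (2 * r - 1))))) ^ q =
      P ^ (-((r + 1) / 2)) * h ^ (-(1/2) : ℝ) := by
    rw [Real.mul_rpow (by positivity) (by positivity), ← Real.rpow_mul hh, ← Real.rpow_mul hP0.le]
    congr 2 <;> · rw [hq]; field_simp
  rw [e1, e2] at hy
  calc _ ≤ Y ^ (-(r - 1)) * (P ^ (-((r - 1) / (2 * r - 1))) *
          P ^ (-((r + 1) / (2 * (2 * r - 1))))) * h ^ (-(1 / (2 * (2 * r - 1)))) := by gcongr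
    _ = _ := by ring
    _ ≤ _ := hy
    _ ≤ _ := add_le_add (div_le_self (by positivity) hpq.lt.le)
        (div_le_self (by positivity) hpq.symm.lt.le)

lemma rpow_kernel_le {r X Y S h J K : ℝ} (hr : 2 ≤ r) (hX : 0 ≤ X) (hY : 0 ≤ Y) (hh : 0 < h)
    (hK : 0 ≤ K) (hXS : X ^ 2 ≤ S) (hYS : 1 + Y ^ 2 ≤ 3 * S)
    (hJ : J ≤ K * ((2 * h / S) ^ 2) ^ (-(1 / (4 * (2 * r - 1))))) :
    X ^ (r - 2) * Y ^ (-(r - 1)) * S ^ (1 - r) * J ≤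
      K * 3 ^ (r / 2) * (Y ^ (-(r - 1/2)) * (1 + Y ^ 2) ^ (-(1/2) : ℝ) +
        (1 + Y ^ 2) ^ (-((r + 1) / 2)) * h ^ (-(1/2) : ℝ)) := by
  set ε : ℝ := 1 / (2 * (2 * r - 1)) with hε
  have hr2 : 0 < 2 * r - 1 := by linarith
  have hε0 : 0 < ε := by positivity
  have hεr : ε ≤ r / 2 := by
    rw [hε, div_le_iff₀ (by positivity)]; nlinarith
  have hP : 0 < 1 + Y ^ 2 := by positivity
  have hS : 0 < S := by linarith
  have hJ' : J ≤ K * (S ^ ε * h ^ (-ε)) := by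
    refine hJ.trans (mul_le_mul_of_nonneg_left ?_ hK)
    rw [← Real.rpow_natCast, ← Real.rpow_mul (by positivity),
      show ((2:ℕ):ℝ) * -(1 / (4 * (2 * r - 1))) = -ε by rw [hε]; push_cast; field_simp; norm_num,
      Real.div_rpow (by positivity) hS.le, Real.rpow_neg hS.le, div_inv_eq_mul, mul_comm]
    gcongr S ^ ε * ?_
    exact Real.rpow_le_rpow_of_nonpos hh (by linarith) (by linarith)
  have hXr : X ^ (r - 2) ≤ S ^ ((r - 2) / 2) := by
    calc X ^ (r - 2) = (X ^ 2) ^ ((r - 2) / 2) := by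
          rw [← Real.rpow_natCast, ← Real.rpow_mul hX]; congr 1; push_cast; ring
      _ ≤ _ := Real.rpow_le_rpow (by positivity) hXS (by linarith)
  have hSP : S ^ (-(r / 2) + ε) ≤ 3 ^ (r / 2) * (1 + Y ^ 2) ^ (-(r / 2) + ε) := by
    calc S ^ (-(r / 2) + ε) ≤ ((1 + Y ^ 2) / 3) ^ (-(r / 2) + ε) :=
          Real.rpow_le_rpow_of_nonpos (by positivity) (by linarith) (by linarith)
      _ = 3 ^ (r / 2 - ε) * (1 + Y ^ 2) ^ (-(r / 2) + ε) := by
          rw [Real.div_rpow hP.le (by norm_num), show -(r / 2) + ε = -(r / 2 - ε) by ring,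
            Real.rpow_neg (x := 3) (by norm_num), div_inv_eq_mul, mul_comm]
      _ ≤ _ := by
          gcongr
          · norm_num
          · linarith
  calc X ^ (r - 2) * Y ^ (-(r - 1)) * S ^ (1 - r) * J
      ≤ X ^ (r - 2) * Y ^ (-(r - 1)) * S ^ (1 - r) * (K * (S ^ ε * h ^ (-ε))) := by
        gcongr
    _ ≤ S ^ ((r - 2) / 2) * Y ^ (-(r - 1)) * S ^ (1 - r) * (K * (S ^ ε * h ^ (-ε))) := by
        gcongr
    _ = K * (Y ^ (-(r - 1)) * (S ^ ((r - 2) / 2) * S ^ (1 - r) * S ^ ε) * h ^ (-ε)) := by ring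
    _ = K * (Y ^ (-(r - 1)) * S ^ (-(r / 2) + ε) * h ^ (-ε)) := by
        rw [← Real.rpow_add hS, ← Real.rpow_add hS]; congr 4; ring
    _ ≤ K * (Y ^ (-(r - 1)) * (3 ^ (r / 2) * (1 + Y ^ 2) ^ (-(r / 2) + ε)) * h ^ (-ε)) := by
        gcongr
    _ = K * 3 ^ (r / 2) * (Y ^ (-(r - 1)) * (1 + Y ^ 2) ^ (-(r / 2) + ε) * h ^ (-ε)) := by ring
    _ ≤ _ := by gcongr; exact rpow_mul_rpow_le_add hr hY hh.le

lemma KMTripleConv_smul {n : ℕ} {s τ : ℝ} (hs : 0 < s) (hτ : 0 ≤ τ)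
    (w : EuclideanSpace ℝ (Fin n)) :
    KMTripleConv n (s ^ 2 * τ) (s • w) = KMTripleConv n τ w := by
  unfold KMTripleConv
  set F : EuclideanSpace ℝ (Fin n) → ℝ := fun x =>
      ‖x‖ ^ ((n : ℝ) - 2) * ‖x - s • w‖ ^ (-((n : ℝ) - 1)) *
        (s ^ 2 * τ + ‖x - s • w‖ ^ 2 + ‖x‖ ^ 2) ^ (1 - (n : ℝ)) *
        ∫ u in (0:ℝ)..1,
          u ^ (((n : ℝ) - 1) / 2 - 1) * (1 - u) ^ (((n : ℝ) - 3) / 2) *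
            (1 - (4 * ‖x‖ ^ 2 * (s ^ 2 * τ + ‖s • w - x‖ ^ 2) /
              (s ^ 2 * τ + ‖s • w - x‖ ^ 2 + ‖x‖ ^ 2) ^ 2) * u) ^ (-((n : ℝ) - 1) / 2) with hF
  have hcov : ∫ x, F x = s ^ (n : ℝ) * ∫ x, F (s • x) := by
    rw [Measure.integral_comp_smul, finrank_euclideanSpace_fin, abs_of_pos (by positivity),
      smul_eq_mul, ← mul_assoc, Real.rpow_natCast, mul_inv_cancel₀ (by positivity), one_mul]
  rw [hcov, norm_smul, Real.norm_of_nonneg hs.le, Real.mul_rpow hs.le (norm_nonneg _)]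
  rw [show ∀ a b c d : ℝ, a * b * (c * d) = b * (a * c * d) from fun _ _ _ _ => by ring,
    ← integral_const_mul]
  congr 1
  refine integral_congr_ae (Filter.Eventually.of_forall fun x => ?_)
  have h1 : ‖s • x - s • w‖ = s * ‖x - w‖ := by
    rw [← smul_sub, norm_smul, Real.norm_of_nonneg hs.le]
  have h2 : ‖s • w - s • x‖ = s * ‖w - x‖ := by
    rw [← smul_sub, norm_smul, Real.norm_of_nonneg hs.le]
  have h3 : ‖s • x‖ = s * ‖x‖ := by rw [norm_smul, Real.norm_of_nonneg hs.le]
  have h4 : 4 * (s * ‖x‖) ^ 2 * (s ^ 2 * τ + (s * ‖w - x‖) ^ 2) /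
      (s ^ 2 * τ + (s * ‖w - x‖) ^ 2 + (s * ‖x‖) ^ 2) ^ 2 =
      4 * ‖x‖ ^ 2 * (τ + ‖w - x‖ ^ 2) / (τ + ‖w - x‖ ^ 2 + ‖x‖ ^ 2) ^ 2 := by
    rw [← mul_div_mul_left _ ((τ + ‖w - x‖ ^ 2 + ‖x‖ ^ 2) ^ 2) (pow_ne_zero 4 hs.ne')]
    congr 1 <;> ring
  have h5 : s ^ 2 * τ + (s * ‖x - w‖) ^ 2 + (s * ‖x‖) ^ 2 =
      s ^ (2 : ℝ) * (τ + ‖x - w‖ ^ 2 + ‖x‖ ^ 2) := by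
    rw [Real.rpow_two]; ring
  simp only [hF, h1, h2, h3, h4, h5]
  rw [Real.mul_rpow hs.le (norm_nonneg _), Real.mul_rpow hs.le (norm_nonneg _),
    Real.mul_rpow (by positivity) (by positivity), ← Real.rpow_mul hs.le]
  have h6 : s ^ ((n : ℝ) - 1) * s ^ (n : ℝ) * (s ^ ((n : ℝ) - 2) * s ^ (-((n : ℝ) - 1)) *
      s ^ (2 * (1 - (n : ℝ)))) = 1 := by
    rw [← Real.rpow_add hs, ← Real.rpow_add hs, ← Real.rpow_add hs, ← Real.rpow_add hs]
    convert Real.rpow_zero s using 2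
    ring
  linear_combination (‖x‖ ^ ((n : ℝ) - 2) * ‖x - w‖ ^ (-((n : ℝ) - 1)) *
        (τ + ‖x - w‖ ^ 2 + ‖x‖ ^ 2) ^ (1 - (n : ℝ)) *
        ∫ u in (0:ℝ)..1,
          u ^ (((n : ℝ) - 1) / 2 - 1) * (1 - u) ^ (((n : ℝ) - 3) / 2) *
            (1 - (4 * ‖x‖ ^ 2 * (τ + ‖w - x‖ ^ 2) /
              (τ + ‖w - x‖ ^ 2 + ‖x‖ ^ 2) ^ 2) * u) ^ (-((n : ℝ) - 1) / 2)) * h6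

lemma exists_KMTripleConv_le_of_norm_eq_one {n : ℕ} (hn : 2 ≤ n) :
    ∃ C : ℝ, 0 ≤ C ∧ ∀ τ : ℝ, 0 < τ → ∀ e : EuclideanSpace ℝ (Fin n), ‖e‖ = 1 →
      KMTripleConv n τ e ≤ C := by
  have hr : (2:ℝ) ≤ n := by exact_mod_cast hn
  have : Nonempty (Fin n) := ⟨⟨0, by omega⟩⟩
  obtain ⟨K, hK, hJ⟩ := exists_euler_integral_le (m := n) (δ := 1 / (4 * (2 * n - 1)))
    (by have : (0:ℝ) < 2 * n - 1 := by linarith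
        positivity)
    (by rw [div_le_iff₀ (by linarith)]; nlinarith)
  obtain ⟨C, hC, hB⟩ := exists_lintegral_japanese_mul_hyperplane_le
    (E := EuclideanSpace ℝ (Fin n)) (N := ((n : ℝ) + 1) / 2)
    (by rw [finrank_euclideanSpace_fin]; linarith)
  have hA := (integrable_norm_rpow_mul_japanese
    (volume : Measure (EuclideanSpace ℝ (Fin n)))).lintegral_lt_top.ne
  rw [finrank_euclideanSpace_fin] at hA
  set A := ∫⁻ y : EuclideanSpace ℝ (Fin n), ENNReal.ofReal (‖y‖ ^ (-((n : ℝ) - 1/2)) *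
      (1 + ‖y‖ ^ 2) ^ (-(1/2) : ℝ))
  set L : ENNReal := ENNReal.ofReal ((K + 1) * 3 ^ ((n : ℝ) / 2)) with hL
  refine ⟨(L * (A + C)).toReal, ENNReal.toReal_nonneg, fun τ hτ e he => ?_⟩
  unfold KMTripleConv
  rw [he, Real.one_rpow, one_mul]
  refine (Real.le_norm_self _).trans ((norm_integral_le_lintegral_norm _).trans ?_)
  refine ENNReal.toReal_mono (ENNReal.mul_ne_top ENNReal.ofReal_ne_top
    (ENNReal.add_ne_top.2 ⟨hA, hC⟩)) ?_
  rw [← lintegral_add_right_eq_self _ e]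
  set c : ℝ := (τ - 1) / 2 with hc
  calc _ ≤ ∫⁻ y : EuclideanSpace ℝ (Fin n), L * (ENNReal.ofReal (‖y‖ ^ (-((n : ℝ) - 1/2)) *
      (1 + ‖y‖ ^ 2) ^ (-(1/2) : ℝ)) + ENNReal.ofReal ((1 + ‖y‖ ^ 2) ^ (-(((n : ℝ) + 1) / 2))) *
        ENNReal.ofReal |inner ℝ y e - c| ^ (-(1/2) : ℝ)) := lintegral_mono fun y => ?_
    _ = L * (A + ∫⁻ y : EuclideanSpace ℝ (Fin n),
          ENNReal.ofReal ((1 + ‖y‖ ^ 2) ^ (-(((n : ℝ) + 1) / 2))) *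
          ENNReal.ofReal |inner ℝ y e - c| ^ (-(1/2) : ℝ)) := by
        rw [lintegral_const_mul _ (by fun_prop), lintegral_add_left (by fun_prop)]
    _ ≤ _ := by gcongr; exact hB e he c
  have hL0 : 0 < (K + 1) * 3 ^ ((n : ℝ) / 2) := by positivity
  have hP : 0 < 1 + ‖y‖ ^ 2 := by positivity
  rcases eq_or_ne (inner ℝ y e - c) 0 with h0 | h0
  · have : L * (ENNReal.ofReal (‖y‖ ^ (-((n : ℝ) - 1/2)) *
      (1 + ‖y‖ ^ 2) ^ (-(1/2) : ℝ)) + ENNReal.ofReal ((1 + ‖y‖ ^ 2) ^ (-(((n : ℝ) + 1) / 2))) *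
        ENNReal.ofReal |inner ℝ y e - c| ^ (-(1/2) : ℝ)) = ⊤ := by
      rw [h0, abs_zero, ENNReal.ofReal_zero, ENNReal.zero_rpow_of_neg (by norm_num),
        ENNReal.mul_top (ENNReal.ofReal_pos.2 (by positivity)).ne', add_top,
        ENNReal.mul_top (ENNReal.ofReal_pos.2 hL0).ne']
    rw [this]
    exact le_top
  have hh : 0 < |inner ℝ y e - c| := abs_pos.2 h0
  rw [ENNReal.ofReal_rpow_of_pos hh, ← ENNReal.ofReal_mul (by positivity),
    ← ENNReal.ofReal_add (by positivity) (by positivity), hL, ← ENNReal.ofReal_mul hL0.le]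
  apply ENNReal.ofReal_le_ofReal
  have hsub : y + e - e = y := by abel
  have hsub' : ‖e - (y + e)‖ = ‖y‖ := by rw [norm_sub_rev, hsub]
  have hX : ‖y + e‖ ^ 2 = ‖y‖ ^ 2 + 2 * inner ℝ y e + 1 := by
    rw [norm_add_sq_real, he]; ring
  simp only [hsub, hsub']
  set S := τ + ‖y‖ ^ 2 + ‖y + e‖ ^ 2 with hS
  have hYS : 1 + ‖y‖ ^ 2 ≤ 3 * S := by
    have h1 : 1 ≤ ‖y‖ + ‖y + e‖ := by
      calc 1 = ‖(y + e) - y‖ := by simp [he]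
        _ ≤ ‖y + e‖ + ‖y‖ := norm_sub_le _ _
        _ = _ := add_comm _ _
    nlinarith [sq_nonneg (‖y‖ - ‖y + e‖), norm_nonneg y, norm_nonneg (y + e)]
  have hSpos : 0 < S := by linarith
  set β := 4 * ‖y + e‖ ^ 2 * (τ + ‖y‖ ^ 2) / S ^ 2 with hβ
  have hβ0 : 0 ≤ β := by positivity
  have h1β : 1 - β = (2 * |inner ℝ y e - c| / S) ^ 2 := by
    rw [hβ, div_pow, mul_pow, sq_abs, eq_div_iff (by positivity), sub_mul, one_mul,
      div_mul_cancel₀ _ (by positivity), hS, hc, hX]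
    ring
  have hβ1 : β < 1 := by
    have : 0 < 1 - β := by rw [h1β]; positivity
    linarith
  have hJ0 := euler_integral_nonneg (m := n) hβ1.le
  have hJ1 := hJ β hβ0 hβ1
  rw [Real.norm_of_nonneg (by positivity)]
  rw [h1β] at hJ1
  refine rpow_kernel_le hr (norm_nonneg _) (norm_nonneg _) hh (by positivity)
    (by rw [hS]; nlinarith [sq_nonneg ‖y‖]) hYS (hJ1.trans ?_)
  gcongr
  linarith

/-- The paper's extension of the Klainerman–Machedon space-time estimate:
`D_τ(w) = D₁(τ^{-1/2} w)` and `D_τ(w)` is uniformly bounded over `τ > 0` and `w ∈ ℝⁿ`. -/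
theorem multilinear_embedding_stmt13 (n : ℕ) (hn : 2 ≤ n) :
    (∀ τ : ℝ, 0 < τ → ∀ w : EuclideanSpace ℝ (Fin n),
      KMTripleConv n τ w = KMTripleConv n 1 (τ ^ (-(1/2 : ℝ)) • w)) ∧
    ∃ C : ℝ, ∀ τ : ℝ, 0 < τ → ∀ w : EuclideanSpace ℝ (Fin n),
      KMTripleConv n τ w ≤ C := by
  refine ⟨fun τ hτ w => ?_, ?_⟩
  · rw [← KMTripleConv_smul (Real.rpow_pos_of_pos hτ (-(1/2))) hτ.le w, ← Real.rpow_natCast,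
      ← Real.rpow_mul hτ.le]
    congr 1
    norm_num [Real.rpow_neg_one, hτ.ne']
  · obtain ⟨C, hC, hb⟩ := exists_KMTripleConv_le_of_norm_eq_one hn
    refine ⟨C, fun τ hτ w => ?_⟩
    have hr : (2:ℝ) ≤ n := by exact_mod_cast hn
    rcases eq_or_ne w 0 with rfl | hw
    · unfold KMTripleConv
      rw [norm_zero, Real.zero_rpow (by linarith), zero_mul]
      exact hC
    · have hw' : 0 < ‖w‖ := norm_pos_iff.2 hw
      rw [← KMTripleConv_smul (inv_pos.2 hw') hτ.le w]
      refine hb _ (by positivity) _ ?_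
      rw [norm_smul, norm_inv, norm_norm, inv_mul_cancel₀ hw'.ne']
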